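/- arXiv:1902.10185 — 2 statements merged into one kernel-verified Lean document; each statement's English description precedes it below -/
import Mathlib

section
/- Let X and Y be topological spaces and suppose there exists a bijection h : X → Y such that h is θ-weakly discontinuous and the inverse h⁻¹ : Y → X is weakly discontinuous. If Y is sw-regular, then X is sw-regular. -/
open Set Topology TopologicalSpace

universe u v w

/-- A set `U` in a topological space is *θ-open* if each of its points has an open
neighborhood whose closure is contained in `U`. -/
def IsThetaOpen {X : Type*} [TopologicalSpace X] (U : Set X) : Prop :=
  ∀ x ∈ U, ∃ O : Set X, IsOpen O ∧ x ∈ O ∧ closure O ⊆ U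

/-- `V` is a θ-open subset of the subspace `A ⊆ X` (with its subspace topology). -/
def IsThetaOpenIn {X : Type*} [TopologicalSpace X] (V A : Set X) : Prop :=
  V ⊆ A ∧ IsThetaOpen ((Subtype.val ⁻¹' V) : Set A)

/-- `C(f|A)`: the set of points of `A` at which the restriction `f|A : A → Y`
(with `A` carrying the subspace topology) is continuous. -/
def ContPts {X Y : Type*} [TopologicalSpace X] [TopologicalSpace Y] (f : X → Y) (A : Set X) :
    Set X :=
  {x | ∃ hx : x ∈ A, ContinuousAt (A.restrict f) ⟨x, hx⟩}

/-- `f` is scatteredly continuous if for every nonempty `A ⊆ X` the set `C(f|A)` is nonempty. -/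
def ScatteredlyContinuous {X Y : Type*} [TopologicalSpace X] [TopologicalSpace Y]
    (f : X → Y) : Prop :=
  ∀ A : Set X, A.Nonempty → (ContPts f A).Nonempty

/-- `f` is weakly discontinuous if for every nonempty `A ⊆ X` the set `C(f|A)` has
nonempty interior in `A`. -/
def WeaklyDiscontinuous {X Y : Type*} [TopologicalSpace X] [TopologicalSpace Y]
    (f : X → Y) : Prop :=
  ∀ A : Set X, A.Nonempty → (interior ((Subtype.val ⁻¹' ContPts f A) : Set A)).Nonempty

/-- `f` is θ-weakly discontinuous if for every nonempty `A ⊆ X` the set `C(f|A)` contains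
a nonempty θ-open subset of the subspace `A`. -/
def ThetaWeaklyDiscontinuous {X Y : Type*} [TopologicalSpace X] [TopologicalSpace Y]
    (f : X → Y) : Prop :=
  ∀ A : Set X, A.Nonempty → ∃ V : Set X, V.Nonempty ∧ V ⊆ ContPts f A ∧ IsThetaOpenIn V A

/-- `X` is sw-regular if every scatteredly continuous function from any topological space
to `X` is weakly discontinuous. -/
def SwRegular.{t, s} (X : Type s) [TopologicalSpace X] : Prop :=
  ∀ (Z : Type t) (_ : TopologicalSpace Z) (f : Z → X),
    ScatteredlyContinuous f → WeaklyDiscontinuous f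

/-- `X` is wθ-regular if every weakly discontinuous function from `X` to any topological
space is θ-weakly discontinuous. -/
def WThetaRegular.{t, s} (X : Type s) [TopologicalSpace X] : Prop :=
  ∀ (Y : Type t) (_ : TopologicalSpace Y) (f : X → Y),
    WeaklyDiscontinuous f → ThetaWeaklyDiscontinuous f

/-- A bijection (given as an equivalence) is a θ-weak homeomorphism if it and its inverse
are θ-weakly discontinuous. -/
def IsThetaWeakHomeomorph {X Y : Type*} [TopologicalSpace X] [TopologicalSpace Y]
    (e : X ≃ Y) : Prop :=
  ThetaWeaklyDiscontinuous (e : X → Y) ∧ ThetaWeaklyDiscontinuous (e.symm : Y → X)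

/-- A bijection (given as an equivalence) is a weak homeomorphism if it and its inverse
are weakly discontinuous. -/
def IsWeakHomeomorph {X Y : Type*} [TopologicalSpace X] [TopologicalSpace Y]
    (e : X ≃ Y) : Prop :=
  WeaklyDiscontinuous (e : X → Y) ∧ WeaklyDiscontinuous (e.symm : Y → X)

/-- `X` is θ-weakly regular if it is θ-weakly homeomorphic to a regular space. -/
def ThetaWeaklyRegular.{t, s} (X : Type s) [TopologicalSpace X] : Prop :=
  ∃ (Y : Type t) (_ : TopologicalSpace Y), RegularSpace Y ∧
    ∃ e : X ≃ Y, IsThetaWeakHomeomorph e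

/-- `X` is weakly regular if it is weakly homeomorphic to a regular space. -/
def WeaklyRegular.{t, s} (X : Type s) [TopologicalSpace X] : Prop :=
  ∃ (Y : Type t) (_ : TopologicalSpace Y), RegularSpace Y ∧
    ∃ e : X ≃ Y, IsWeakHomeomorph e

section Reformulations

variable {X Y Z : Type*} [TopologicalSpace X] [TopologicalSpace Y] [TopologicalSpace Z]

lemma mem_contPts_iff {f : X → Y} {A : Set X} {x : X} :
    x ∈ ContPts f A ↔ x ∈ A ∧ ContinuousWithinAt f A x := by
  constructor
  · rintro ⟨hx, hc⟩
    exact ⟨hx, (continuousWithinAt_iff_continuousAt_domRestrict f hx).2 hc⟩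
  · rintro ⟨hx, hc⟩
    exact ⟨hx, (continuousWithinAt_iff_continuousAt_domRestrict f hx).1 hc⟩

lemma weaklyDiscontinuous_iff_exists_continuousOn {f : X → Y} :
    WeaklyDiscontinuous f ↔ ∀ A : Set X, A.Nonempty →
      ∃ W, IsOpen W ∧ (A ∩ W).Nonempty ∧ ContinuousOn f (A ∩ W) := by
  refine forall₂_congr fun A _ => ⟨?_, ?_⟩
  · rintro ⟨x, hx⟩
    obtain ⟨W, hW, hWi⟩ := isOpen_induced_iff.1 (isOpen_interior (s := (Subtype.val ⁻¹'
      ContPts f A : Set A)))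
    refine ⟨W, hW, ⟨x, x.2, ?_⟩, fun y hy => ?_⟩
    · rw [← hWi] at hx
      exact hx
    · have hyi : (⟨y, hy.1⟩ : A) ∈ interior (Subtype.val ⁻¹' ContPts f A : Set A) := by
        rw [← hWi]
        exact hy.2
      have hyC : y ∈ ContPts f A := by simpa using interior_subset hyi
      exact (mem_contPts_iff.1 hyC).2.mono inter_subset_left
  · rintro ⟨W, hW, ⟨x, hxA, hxW⟩, hc⟩
    refine ⟨⟨x, hxA⟩, mem_interior.2 ⟨Subtype.val ⁻¹' W, fun y hy => ?_,
      hW.preimage continuous_subtype_val, hxW⟩⟩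
    exact mem_contPts_iff.2
      ⟨y.2, (continuousWithinAt_inter (hW.mem_nhds hy)).1 (hc y ⟨y.2, hy⟩)⟩

lemma ScatteredlyContinuous.exists_continuousWithinAt {f : X → Y}
    (hf : ScatteredlyContinuous f) {A W : Set X} (hW : IsOpen W) (hne : (A ∩ W).Nonempty) :
    ∃ x ∈ A ∩ W, ContinuousWithinAt f A x := by
  obtain ⟨x, hx⟩ := hf _ hne
  obtain ⟨hxA, hc⟩ := mem_contPts_iff.1 hx
  exact ⟨x, hxA, (continuousWithinAt_inter (hW.mem_nhds hxA.2)).1 hc⟩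

lemma ScatteredlyContinuous.comp_continuous {f : X → Y}
    (hf : ScatteredlyContinuous f) {i : Z → X} (hi : Continuous i) :
    ScatteredlyContinuous (f ∘ i) := by
  intro B hB
  obtain ⟨_, hx⟩ := hf _ (hB.image i)
  obtain ⟨⟨z, hz, rfl⟩, hc⟩ := mem_contPts_iff.1 hx
  exact ⟨z, mem_contPts_iff.2
    ⟨hz, hc.comp hi.continuousWithinAt (mapsTo_image i B)⟩⟩

lemma ScatteredlyContinuous.continuousOn_comp {f : X → Y} (hf : ScatteredlyContinuous f)
    {h : Y → Z} (hh : ContinuousOn h (range f)) : ScatteredlyContinuous (h ∘ f) := by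
  intro B hB
  obtain ⟨x, hx⟩ := hf B hB
  obtain ⟨hxB, hc⟩ := mem_contPts_iff.1 hx
  exact ⟨x, mem_contPts_iff.2
    ⟨hxB, (hh (f x) (mem_range_self x)).comp hc fun y _ => mem_range_self y⟩⟩

lemma WeaklyDiscontinuous.comp {g : Y → Z} {f : X → Y} (hg : WeaklyDiscontinuous g)
    (hf : WeaklyDiscontinuous f) : WeaklyDiscontinuous (g ∘ f) := by
  rw [weaklyDiscontinuous_iff_exists_continuousOn] at *
  intro A hA
  obtain ⟨W, hW, hne, hc⟩ := hf A hA
  obtain ⟨O, hO, ⟨_, ⟨x, hx, rfl⟩, hxO⟩, hgc⟩ := hg _ (hne.image f)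
  obtain ⟨W', hW', hWO⟩ := continuousOn_iff'.1 hc O hO
  have hxW' : x ∈ W' ∩ (A ∩ W) := hWO ▸ ⟨hxO, hx⟩
  refine ⟨W ∩ W', hW.inter hW', ⟨x, hx.1, hx.2, hxW'.1⟩, ?_⟩
  refine hgc.comp (hc.mono fun y hy => ⟨hy.1, hy.2.1⟩) fun y hy => ?_
  have hy' : y ∈ f ⁻¹' O ∩ (A ∩ W) := hWO ▸ ⟨hy.2.2, hy.1, hy.2.1⟩
  exact ⟨mem_image_of_mem f hy'.2, hy'.1⟩

lemma IsThetaOpenIn.exists_closure_inter_subset {V A : Set X} (hV : IsThetaOpenIn V A) {x : X}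
    (hx : x ∈ V) : ∃ O, IsOpen O ∧ x ∈ O ∧ closure (O ∩ A) ∩ A ⊆ V := by
  obtain ⟨O', hO', hxO', hcl⟩ := hV.2 ⟨x, hV.1 hx⟩ hx
  obtain ⟨O, hO, rfl⟩ := isOpen_induced_iff.1 hO'
  refine ⟨O, hO, hxO', fun y hy => ?_⟩
  refine @hcl ⟨y, hy.2⟩ (closure_subtype.2 ?_)
  rw [Subtype.image_preimage_coe, inter_comm]
  exact hy.1

lemma IsThetaOpenIn.of_closure_inter_subset {V A : Set X} (hVA : V ⊆ A)
    (hV : ∀ x ∈ V, ∃ O, IsOpen O ∧ x ∈ O ∧ closure (O ∩ A) ∩ A ⊆ V) : IsThetaOpenIn V A := by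
  refine ⟨hVA, fun x hx => ?_⟩
  obtain ⟨O, hO, hxO, hcl⟩ := hV x hx
  refine ⟨Subtype.val ⁻¹' O, hO.preimage continuous_subtype_val, hxO, fun y hy => ?_⟩
  refine hcl ⟨?_, y.2⟩
  rw [closure_subtype, Subtype.image_preimage_coe, inter_comm] at hy
  exact hy

lemma IsThetaOpenIn.inter {V A B : Set X} (hV : IsThetaOpenIn V A) (hBA : B ⊆ A) :
    IsThetaOpenIn (V ∩ B) B := by
  refine .of_closure_inter_subset inter_subset_right fun x hx => ?_
  obtain ⟨O, hO, hxO, hcl⟩ := hV.exists_closure_inter_subset hx.1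
  exact ⟨O, hO, hxO, fun y hy =>
    ⟨hcl ⟨closure_mono (inter_subset_inter_right O hBA) hy.1, hBA hy.2⟩, hy.2⟩⟩

lemma IsThetaOpenIn.isOpen_union {V U : Set X} (hV : IsThetaOpenIn V Uᶜ) (hU : IsOpen U) :
    IsOpen (U ∪ V) := by
  refine isOpen_iff_mem_nhds.2 fun x hx => ?_
  rcases hx with hx | hx
  · exact Filter.mem_of_superset (hU.mem_nhds hx) subset_union_left
  · obtain ⟨O, hO, hxO, hcl⟩ := hV.exists_closure_inter_subset hx
    refine Filter.mem_of_superset (hO.mem_nhds hxO) fun y hy => ?_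
    by_cases hyU : y ∈ U
    · exact Or.inl hyU
    · exact Or.inr (hcl ⟨subset_closure ⟨hy, hyU⟩, hyU⟩)

end Reformulations

/-- An open set `U` is *θ-exhaustible* if, whatever open set `G` not containing `U` has been
removed from the space, some nonempty θ-open subset of the remainder lies in `U`. -/
def ThetaExhaustible {X : Type*} [TopologicalSpace X] (U : Set X) : Prop :=
  IsOpen U ∧ ∀ G : Set X, IsOpen G → ¬ U ⊆ G →
    ∃ V : Set X, V.Nonempty ∧ V ⊆ U ∧ IsThetaOpenIn V Gᶜ

section Exhaustion

variable {X Z : Type*} [TopologicalSpace X] [TopologicalSpace Z]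

lemma ThetaExhaustible.sUnion {𝒰 : Set (Set X)} (h𝒰 : ∀ U ∈ 𝒰, ThetaExhaustible U) :
    ThetaExhaustible (⋃₀ 𝒰) := by
  refine ⟨isOpen_sUnion fun U hU => (h𝒰 U hU).1, fun G hG hne => ?_⟩
  rw [sUnion_subset_iff] at hne
  push Not at hne
  obtain ⟨U, hU, hUG⟩ := hne
  obtain ⟨V, hVne, hVU, hV⟩ := (h𝒰 U hU).2 G hG hUG
  exact ⟨V, hVne, hVU.trans (subset_sUnion_of_mem hU), hV⟩

lemma ThetaExhaustible.union {U V : Set X} (hU : ThetaExhaustible U)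
    (hV : IsThetaOpenIn V Uᶜ) : ThetaExhaustible (U ∪ V) := by
  refine ⟨hV.isOpen_union hU.1, fun G hG hne => ?_⟩
  by_cases hUG : U ⊆ G
  · obtain ⟨x, hx, hxG⟩ := not_subset.1 hne
    exact ⟨V ∩ Gᶜ, ⟨x, hx.resolve_left fun h => hxG (hUG h), hxG⟩,
      inter_subset_left.trans subset_union_right, hV.inter (compl_subset_compl.2 hUG)⟩
  · obtain ⟨V', hne', hV'U, hV'⟩ := hU.2 G hG hUG
    exact ⟨V', hne', hV'U.trans subset_union_left, hV'⟩

/-- If the points of continuity of `f|A` avoid the preimage of a θ-exhaustible set `U`, then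
this preimage is not dense in any nonempty relatively open subset of `A`. -/
lemma ScatteredlyContinuous.exists_disjoint_preimage {f : Z → X} (hf : ScatteredlyContinuous f)
    {A W : Set Z} {U : Set X} (hU : ThetaExhaustible U) (hW : IsOpen W)
    (hne : (A ∩ W).Nonempty) (hAU : ∀ x ∈ A, ContinuousWithinAt f A x → f x ∉ U) :
    ∃ W', IsOpen W' ∧ W' ⊆ W ∧ (A ∩ W').Nonempty ∧ ∀ x ∈ A ∩ W', f x ∉ U := by
  by_contra! hcon
  set S := A ∩ W ∩ f ⁻¹' U
  set G := interior (f '' {x ∈ S | ContinuousWithinAt f S x})ᶜ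
  -- `G` is the largest open set that misses the image of the continuity points of `f|S`.
  have hSdense : ∀ N, IsOpen N → N ⊆ W → (A ∩ N).Nonempty →
      ∃ d ∈ S ∩ N, ContinuousWithinAt f S d := by
    intro N hN hNW hAN
    obtain ⟨x, hx, hxU⟩ := hcon N hN hNW hAN
    exact hf.exists_continuousWithinAt hN ⟨x, ⟨⟨hx.1, hNW hx.2⟩, hxU⟩, hx.2⟩
  have hnotG : ∀ d ∈ S, ContinuousWithinAt f S d → f d ∉ G := fun d hd hdc hdG =>
    interior_subset hdG ⟨d, ⟨hd, hdc⟩, rfl⟩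
  obtain ⟨d₀, hd₀, hd₀c⟩ := hSdense W hW subset_rfl hne
  obtain ⟨V, ⟨v, hv⟩, hVU, hV⟩ := hU.2 G isOpen_interior
    fun h => hnotG d₀ hd₀.1 hd₀c (h hd₀.1.2)
  obtain ⟨s, hsS, hsc, hsV⟩ : ∃ s ∈ S, ContinuousWithinAt f S s ∧ f s ∈ V := by
    by_contra! h
    refine hV.1 hv (interior_maximal ?_ (hV.isOpen_union isOpen_interior) (Or.inr hv))
    rintro _ hy ⟨d, ⟨hd, hdc⟩, rfl⟩
    exact hy.elim (hnotG d hd hdc) (h d hd hdc)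
  obtain ⟨O, hO, hsO, hcl⟩ := hV.exists_closure_inter_subset hsV
  obtain ⟨N, hN, hsN, hNO⟩ := mem_nhdsWithin.1 (hsc (hO.mem_nhds hsO))
  obtain ⟨t, ht, htc⟩ := hf.exists_continuousWithinAt (hN.inter hW)
    (A := A) ⟨s, hsS.1.1, hsN, hsS.1.2⟩
  -- Continuity points of `f|S` accumulate at `t`, so `f t` lies in `closure (O ∩ Gᶜ) ∩ Gᶜ`.
  have hfreq : ∀ P : Set X, P ∈ 𝓝 (f t) → ∃ d, f d ∈ P ∧ f d ∈ O ∧ f d ∉ G := by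
    intro P hP
    obtain ⟨N', hN', htN', hN'P⟩ := mem_nhdsWithin.1 (htc hP)
    obtain ⟨d, hd, hdc⟩ := hSdense (N' ∩ (N ∩ W)) (hN'.inter (hN.inter hW))
      (fun x hx => hx.2.2) ⟨t, ht.1, htN', ht.2⟩
    exact ⟨d, hN'P ⟨hd.2.1, hd.1.1.1⟩, hNO ⟨hd.2.2.1, hd.1⟩, hnotG d hd.1 hdc⟩
  have htG : f t ∉ G := fun h => by
    obtain ⟨d, hdG, -, hd⟩ := hfreq G (isOpen_interior.mem_nhds h)
    exact hd hdG
  refine hAU t ht.1 htc (hVU (hcl ⟨mem_closure_iff_nhds.2 fun P hP => ?_, htG⟩))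
  obtain ⟨d, hdP, hd⟩ := hfreq P hP
  exact ⟨f d, hdP, hd⟩

lemma ThetaWeaklyDiscontinuous.exists_isThetaOpenIn_continuousOn {Y : Type*} [TopologicalSpace Y]
    {h : X → Y} (hh : ThetaWeaklyDiscontinuous h) {A : Set X} (hA : A.Nonempty) :
    ∃ V : Set X, V.Nonempty ∧ IsThetaOpenIn V A ∧ ContinuousOn h V := by
  obtain ⟨V, hne, hVc, hV⟩ := hh A hA
  exact ⟨V, hne, hV, fun x hx => (mem_contPts_iff.1 (hVc hx)).2.mono hV.1⟩

/-- If `f` is scatteredly continuous and `h` is θ-weakly discontinuous, then every nonempty set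
has a nonempty relatively open subset whose image under `f` is a set on which `h` is
continuous. -/
lemma ScatteredlyContinuous.exists_continuousOn_image {Y : Type*} [TopologicalSpace Y]
    {f : Z → X} (hf : ScatteredlyContinuous f) {h : X → Y} (hh : ThetaWeaklyDiscontinuous h)
    {A : Set Z} (hA : A.Nonempty) :
    ∃ W, IsOpen W ∧ (A ∩ W).Nonempty ∧ ContinuousOn h (f '' (A ∩ W)) := by
  set 𝒰 : Set (Set X) :=
    {U | ThetaExhaustible U ∧ ∀ x ∈ A, ContinuousWithinAt f A x → f x ∉ U}
  have hU : ThetaExhaustible (⋃₀ 𝒰) := .sUnion fun U hU => hU.1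
  have hAU : ∀ x ∈ A, ContinuousWithinAt f A x → f x ∉ ⋃₀ 𝒰 := by
    rintro x hx hxc ⟨U, hU, hxU⟩
    exact hU.2 x hx hxc hxU
  obtain ⟨x₀, hx₀⟩ := hf A hA
  obtain ⟨hx₀A, hx₀c⟩ := mem_contPts_iff.1 hx₀
  obtain ⟨V, ⟨v, hv⟩, hV, hhV⟩ := hh.exists_isThetaOpenIn_continuousOn (A := (⋃₀ 𝒰)ᶜ)
    ⟨f x₀, hAU x₀ hx₀A hx₀c⟩
  obtain ⟨t, htA, htc, htV⟩ : ∃ t ∈ A, ContinuousWithinAt f A t ∧ f t ∈ ⋃₀ 𝒰 ∪ V := by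
    by_contra! hcon
    exact hV.1 hv ⟨_, ⟨hU.union hV, hcon⟩, Or.inr hv⟩
  obtain ⟨W, hW, htW, hWV⟩ :=
    mem_nhdsWithin.1 (htc ((hV.isOpen_union hU.1).mem_nhds htV))
  obtain ⟨W', hW', hW'W, hne, hdisj⟩ := hf.exists_disjoint_preimage hU hW ⟨t, htA, htW⟩ hAU
  refine ⟨W', hW', hne, hhV.mono ?_⟩
  rintro _ ⟨x, hx, rfl⟩
  exact (hWV ⟨hW'W hx.2, hx.1⟩).resolve_left (hdisj x hx)

end Exhaustion

theorem swRegular_of_thetaWeakly_discontinuous_bijection {X : Type u} {Y : Type v}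
    [TopologicalSpace X] [TopologicalSpace Y] (h : X → Y) (g : Y → X)
    (hgl : Function.LeftInverse g h) (hgr : Function.RightInverse g h)
    (hh : ThetaWeaklyDiscontinuous h) (hg : WeaklyDiscontinuous g)
    (hY : SwRegular.{w, v} Y) : SwRegular.{w, u} X := by
  intro Z _ f hf
  rw [weaklyDiscontinuous_iff_exists_continuousOn]
  intro A hA
  obtain ⟨W, hW, ⟨x, hx⟩, hhc⟩ := hf.exists_continuousOn_image hh hA
  have hfi : ScatteredlyContinuous (f ∘ (Subtype.val : ↥(A ∩ W) → Z)) :=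
    hf.comp_continuous continuous_subtype_val
  have hhfi : ScatteredlyContinuous (h ∘ f ∘ (Subtype.val : ↥(A ∩ W) → Z)) := by
    refine hfi.continuousOn_comp ?_
    rwa [range_comp, Subtype.range_coe]
  have hwd : WeaklyDiscontinuous (f ∘ (Subtype.val : ↥(A ∩ W) → Z)) := by
    have hcomp := hg.comp (hY _ _ _ hhfi)
    rwa [← Function.comp_assoc, hgl.comp_eq_id, Function.id_comp] at hcomp
  obtain ⟨O, hO, ⟨y, -, hyO⟩, hc⟩ :=
    weaklyDiscontinuous_iff_exists_continuousOn.1 hwd univ ⟨⟨x, hx⟩, mem_univ _⟩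
  obtain ⟨W', hW', rfl⟩ := isOpen_induced_iff.1 hO
  refine ⟨W ∩ W', hW.inter hW', ⟨y, y.2.1, y.2.2, hyO⟩, ?_⟩
  rw [← inter_assoc, ← Subtype.image_preimage_coe]
  rw [univ_inter] at hc
  exact IsInducing.subtypeVal.continuousOn_image_iff.2 hc
end

section
/- A first-countable Hausdorff topological space X is not regular if and only if X contains a subspace homeomorphic to the Gutik hedgehog (equivalently, there exists a topological embedding of the Gutik hedgehog into X). -/
open Set Topology TopologicalSpace

universe u v w

/-- The underlying set of the Gutik hedgehog: sequences of natural numbers of length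
at most `2`.  `root` is the empty sequence, `spine n` the one-element sequence `(n)`,
and `tip n m` the two-element sequence `(n, m)`. -/
inductive GutikPoint : Type
  | root : GutikPoint
  | spine (n : ℕ) : GutikPoint
  | tip (n m : ℕ) : GutikPoint

namespace GutikPoint

/-- The basic neighborhood `U_n = {∅} ∪ {(i,j) ∈ ℕ² : i ≥ n}` of the root. -/
def Un (n : ℕ) : Set GutikPoint :=
  {x | x = root ∨ ∃ i j, n ≤ i ∧ x = tip i j}

/-- The basic neighborhood `U_{n,m} = {(n)} ∪ {(n,j) : j ≥ m}` of the spine point `(n)`. -/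
def Unm (n m : ℕ) : Set GutikPoint :=
  {x | x = spine n ∨ ∃ j, m ≤ j ∧ x = tip n j}

/-- The topology of the Gutik hedgehog, generated by the base consisting of the
singletons of points of `ℕ²` and the sets `U_n` and `U_{n,m}`. -/
instance : TopologicalSpace GutikPoint :=
  TopologicalSpace.generateFrom
    {S | (∃ n m, S = {tip n m}) ∨ (∃ n, S = Un n) ∨ (∃ n m, S = Unm n m)}

end GutikPoint

open Filter

theorem exists_strictMono_forall_lt_of_eventually {R : ℕ → ℕ → Prop}
    (h : ∀ n, ∀ᶠ m in atTop, R n m) :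
    ∃ φ : ℕ → ℕ, StrictMono φ ∧ ∀ i j, i < j → R (φ i) (φ j) := by
  choose g hg using fun n => eventually_atTop.1 (h n)
  let φ : ℕ → ℕ := fun n => Nat.rec 0 (fun _ p => max (p + 1) (g p)) n
  have hsucc : ∀ n, φ (n + 1) = max (φ n + 1) (g (φ n)) := fun _ => rfl
  have hφ : StrictMono φ := strictMono_nat_of_lt_succ fun n => by rw [hsucc]; omega
  refine ⟨φ, hφ, fun i j hij => hg _ _ ?_⟩
  have h1 := hφ.monotone (Nat.succ_le_of_lt hij)
  have h2 := hsucc i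
  simp only [Nat.succ_eq_add_one] at h1
  omega

/-- The limit of a sequence together with any selection of its terms is compact. -/
theorem isCompact_insert_image_of_tendsto {X : Type*} [TopologicalSpace X] {z : ℕ → X} {y : X}
    (h : Tendsto z atTop (𝓝 y)) (A : Set ℕ) : IsCompact (insert y (z '' A)) := by
  rw [← Nat.cofinite_eq_atTop] at h
  have h' : Tendsto (z ∘ ((↑) : A → ℕ)) cofinite (𝓝 y) :=
    h.comp Subtype.val_injective.tendsto_cofinite
  have := h'.isCompact_insert_range_of_cofinite
  rwa [range_comp, Subtype.range_coe] at this

namespace GutikPoint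

theorem isOpen_iff {S : Set GutikPoint} :
    IsOpen S ↔ (root ∈ S → ∃ n, Un n ⊆ S) ∧ ∀ n, spine n ∈ S → ∃ m, Unm n m ⊆ S := by
  constructor
  · intro h
    induction h with
    | basic S hS =>
      rcases hS with ⟨n, m, rfl⟩ | ⟨n, rfl⟩ | ⟨n, m, rfl⟩
      · simp
      · exact ⟨fun _ => ⟨n, subset_rfl⟩, by simp [Un]⟩
      · refine ⟨by simp [Unm], fun k hk => ⟨m, ?_⟩⟩
        obtain rfl : k = n := by simpa [Unm] using hk
        exact subset_rfl
    | univ => exact ⟨fun _ => ⟨0, subset_univ _⟩, fun _ _ => ⟨0, subset_univ _⟩⟩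
    | inter S T _ _ hS hT =>
      refine ⟨fun h => ?_, fun k h => ?_⟩
      · obtain ⟨a, ha⟩ := hS.1 h.1
        obtain ⟨b, hb⟩ := hT.1 h.2
        refine ⟨max a b, fun p hp => ⟨ha ?_, hb ?_⟩⟩ <;>
        · rcases hp with rfl | ⟨i, j, hij, rfl⟩
          · exact Or.inl rfl
          · exact Or.inr ⟨i, j, by omega, rfl⟩
      · obtain ⟨a, ha⟩ := hS.2 k h.1
        obtain ⟨b, hb⟩ := hT.2 k h.2
        refine ⟨max a b, fun p hp => ⟨ha ?_, hb ?_⟩⟩ <;>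
        · rcases hp with rfl | ⟨j, hij, rfl⟩
          · exact Or.inl rfl
          · exact Or.inr ⟨j, by omega, rfl⟩
    | sUnion 𝒮 _ ih =>
      refine ⟨fun ⟨S, hS, h⟩ => ?_, fun k ⟨S, hS, h⟩ => ?_⟩
      · obtain ⟨a, ha⟩ := (ih S hS).1 h
        exact ⟨a, ha.trans (subset_sUnion_of_mem hS)⟩
      · obtain ⟨a, ha⟩ := (ih S hS).2 k h
        exact ⟨a, ha.trans (subset_sUnion_of_mem hS)⟩
  · rintro ⟨hr, hs⟩
    refine isOpen_iff_forall_mem_open.2 fun p hp => ?_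
    cases p with
    | root =>
      obtain ⟨n, hn⟩ := hr hp
      exact ⟨_, hn, isOpen_generateFrom_of_mem (Or.inr (Or.inl ⟨n, rfl⟩)), Or.inl rfl⟩
    | spine n =>
      obtain ⟨m, hm⟩ := hs n hp
      exact ⟨_, hm, isOpen_generateFrom_of_mem (Or.inr (Or.inr ⟨n, m, rfl⟩)), Or.inl rfl⟩
    | tip n m =>
      exact ⟨{tip n m}, singleton_subset_iff.2 hp,
        isOpen_generateFrom_of_mem (Or.inl ⟨n, m, rfl⟩), rfl⟩

theorem not_regularSpace : ¬ RegularSpace GutikPoint := by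
  intro _
  have hU : Un 0 ∈ 𝓝 root :=
    (isOpen_generateFrom_of_mem (Or.inr (Or.inl ⟨0, rfl⟩))).mem_nhds (Or.inl rfl)
  obtain ⟨C, hC, hCc, hCU⟩ := exists_mem_nhds_isClosed_subset hU
  obtain ⟨W, hWC, hWo, hW⟩ := mem_nhds_iff.1 hC
  obtain ⟨n, hn⟩ := (isOpen_iff.1 hWo).1 hW
  have hsp : spine n ∈ Cᶜ := fun h => by simpa [Un] using hCU h
  obtain ⟨m, hm⟩ := (isOpen_iff.1 hCc.isOpen_compl).2 n hsp
  exact hm (Or.inr ⟨m, le_rfl, rfl⟩) (hWC (hn (Or.inr ⟨n, m, le_rfl, rfl⟩)))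

/-- The map out of the Gutik hedgehog with prescribed values at the three kinds of points. -/
def lift {X : Type*} (x : X) (y : ℕ → X) (z : ℕ → ℕ → X) : GutikPoint → X
  | root => x
  | spine n => y n
  | tip n m => z n m

section Lift

variable {X : Type*} [TopologicalSpace X] {x : X} {y : ℕ → X} {z : ℕ → ℕ → X} {V : ℕ → Set X}

theorem continuous_lift (hV : (𝓝 x).HasAntitoneBasis V) (hzV : ∀ n k, z n k ∈ V n)
    (hzy : ∀ n, Tendsto (z n) atTop (𝓝 (y n))) : Continuous (lift x y z) := by
  refine continuous_def.2 fun O hO => isOpen_iff.2 ⟨fun h => ?_, fun n h => ?_⟩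
  · obtain ⟨n, hn⟩ := hV.mem_iff.1 (hO.mem_nhds h)
    refine ⟨n, ?_⟩
    rintro _ (rfl | ⟨i, j, hi, rfl⟩)
    · exact h
    · exact hn (hV.antitone hi (hzV i j))
  · obtain ⟨m, hm⟩ := eventually_atTop.1 ((hzy n).eventually (hO.mem_nhds h))
    refine ⟨m, ?_⟩
    rintro _ (rfl | ⟨j, hj, rfl⟩)
    · exact h
    · exact hm j hj

variable [T2Space X]

/-- The tails of a sequence of sets shrinking to `x` stay away from compact sets missing `x`. -/
theorem eventually_disjoint_closure (hV : (𝓝 x).HasAntitoneBasis V) {K : Set X}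
    (hK : IsCompact K) (hx : x ∉ K) : ∀ᶠ m in atTop, Disjoint K (closure (V m)) := by
  obtain ⟨A, B, hA, hB, hKA, hxB, hAB⟩ := hK.separation_of_notMem hx
  obtain ⟨n, hn⟩ := hV.mem_iff.1 (hB.mem_nhds hxB)
  filter_upwards [eventually_ge_atTop n] with m hm
  exact ((hAB.mono_right ((hV.antitone hm).trans hn)).closure_right hA).mono_left hKA

theorem isEmbedding_lift {U : Set X} (hV : (𝓝 x).HasAntitoneBasis V) (hU : U ∈ 𝓝 x)
    (hyU : ∀ n, y n ∉ U) (hzU : ∀ n k, z n k ∈ U) (hzV : ∀ n k, z n k ∈ V n)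
    (hzx : ∀ n k, z n k ≠ x) (hinj : ∀ n, Function.Injective (z n))
    (hzy : ∀ n, Tendsto (z n) atTop (𝓝 (y n)))
    (hdisj : ∀ i j, i < j → Disjoint (insert (y i) (range (z i))) (closure (V j))) :
    IsEmbedding (lift x y z) := by
  set K : ℕ → Set X := fun i => insert (y i) (range (z i))
  have hyK : ∀ n, y n ∈ K n := fun n => Or.inl rfl
  have hzK : ∀ n k, z n k ∈ K n := fun n k => Or.inr ⟨k, rfl⟩
  have hKc : ∀ i, IsClosed (K i) := fun i => by
    have := (isCompact_insert_image_of_tendsto (hzy i) univ).isClosed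
    rwa [image_univ] at this
  have hKV : ∀ i, K i ⊆ closure (V i) := by
    rintro i _ (rfl | ⟨k, rfl⟩)
    · exact mem_closure_of_tendsto (hzy i) (Eventually.of_forall (hzV i))
    · exact subset_closure (hzV i k)
  have hxK : ∀ i, x ∉ K i := by
    rintro i (h | ⟨k, h⟩)
    · exact hyU i (h ▸ mem_of_mem_nhds hU)
    · exact hzx i k h
  have hKK : ∀ i j, i ≠ j → Disjoint (K i) (K j) := fun i j hij => by
    rcases hij.lt_or_gt with h | h
    · exact (hdisj i j h).mono_right (hKV j)
    · exact ((hdisj j i h).mono_right (hKV i)).symm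
  have hyz : ∀ n m k, y n ≠ z m k := fun n m k h => hyU n (h ▸ hzU m k)
  have hfin : ∀ s : Set ℕ, s.Finite → IsClosed (⋃ i ∈ s, K i) := fun s hs =>
    hs.isClosed_biUnion fun i _ => hKc i
  have hsep : ∀ n, ∀ w ∈ K n, ∃ W ∈ 𝓝 w, x ∉ W ∧ ∀ i ≠ n, Disjoint W (K i) := by
    intro n w hw
    have hwx : x ∉ ({w} : Set X) := fun h => hxK n (mem_singleton_iff.1 h ▸ hw)
    obtain ⟨N, hN⟩ := (eventually_disjoint_closure hV isCompact_singleton hwx).exists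
    refine ⟨(closure (V N))ᶜ ∩ (⋃ i ∈ {i | i < N ∧ i ≠ n}, K i)ᶜ, inter_mem ?_ ?_, ?_, ?_⟩
    · exact isClosed_closure.isOpen_compl.mem_nhds (disjoint_singleton_left.1 hN)
    · refine (hfin _ ((finite_lt_nat N).subset fun i hi => hi.1)).isOpen_compl.mem_nhds ?_
      simp only [mem_compl_iff, mem_iUnion, not_exists]
      exact fun i hi hwi => disjoint_left.1 (hKK i n hi.2) hwi hw
    · exact fun h => h.1 (subset_closure (mem_of_mem_nhds (hV.mem N)))
    · refine fun i hi => disjoint_left.2 fun p hp hpi => ?_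
      by_cases hiN : i < N
      · exact hp.2 (mem_biUnion (show i ∈ {i | i < N ∧ i ≠ n} from ⟨hiN, hi⟩) hpi)
      · exact hp.1 (closure_mono (hV.antitone (not_lt.1 hiN)) (hKV i hpi))
  have hroot : ∀ n, ∃ W ∈ 𝓝 x, lift x y z ⁻¹' W ⊆ Un n := by
    intro n
    refine ⟨U ∩ (⋃ i ∈ {i | i < n}, K i)ᶜ, inter_mem hU ?_, ?_⟩
    · refine (hfin _ (finite_lt_nat n)).isOpen_compl.mem_nhds ?_
      simp only [mem_compl_iff, mem_iUnion, not_exists]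
      exact fun i _ => hxK i
    · rintro (_ | i | ⟨i, j⟩) hp
      · exact Or.inl rfl
      · exact absurd hp.1 (hyU i)
      · refine Or.inr ⟨i, j, ?_, rfl⟩
        by_contra! hi
        exact hp.2 (mem_biUnion (show i ∈ {i | i < n} from hi) (hzK i j))
  have hspine : ∀ n m, ∃ W ∈ 𝓝 (y n), lift x y z ⁻¹' W ⊆ Unm n m := by
    intro n m
    obtain ⟨W, hW, hxW, hWK⟩ := hsep n (y n) (hyK n)
    refine ⟨W ∩ (z n '' {j | j < m})ᶜ, inter_mem hW ?_, ?_⟩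
    · refine ((finite_lt_nat m).image _).isClosed.isOpen_compl.mem_nhds ?_
      rintro ⟨j, -, h⟩
      exact hyz n n j h.symm
    · rintro (_ | i | ⟨i, j⟩) hp
      · exact absurd hp.1 hxW
      · obtain rfl : i = n := by
          by_contra hi
          exact disjoint_left.1 (hWK i hi) hp.1 (hyK i)
        exact Or.inl rfl
      · obtain rfl : i = n := by
          by_contra hi
          exact disjoint_left.1 (hWK i hi) hp.1 (hzK i j)
        refine Or.inr ⟨j, ?_, rfl⟩
        by_contra! hj
        exact hp.2 ⟨j, hj, rfl⟩
  have htip : ∀ n m, ∃ W ∈ 𝓝 (z n m), lift x y z ⁻¹' W ⊆ {tip n m} := by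
    intro n m
    obtain ⟨W, hW, hxW, hWK⟩ := hsep n (z n m) (hzK n m)
    refine ⟨W ∩ (insert (y n) (z n '' {m}ᶜ))ᶜ, inter_mem hW ?_, ?_⟩
    · refine (isCompact_insert_image_of_tendsto (hzy n) _).isClosed.isOpen_compl.mem_nhds ?_
      rintro (h | ⟨j, hj, h⟩)
      · exact hyz n n m h.symm
      · exact hj (hinj n h)
    · rintro (_ | i | ⟨i, j⟩) hp
      · exact absurd hp.1 hxW
      · obtain rfl : i = n := by
          by_contra hi
          exact disjoint_left.1 (hWK i hi) hp.1 (hyK i)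
        exact absurd (Or.inl rfl) hp.2
      · obtain rfl : i = n := by
          by_contra hi
          exact disjoint_left.1 (hWK i hi) hp.1 (hzK i j)
        obtain rfl : j = m := by
          by_contra hj
          exact hp.2 (Or.inr ⟨j, hj, rfl⟩)
        rfl
  have hind : IsInducing (lift x y z) := by
    refine ⟨le_antisymm (continuous_lift hV hzV hzy).le_induced (le_generateFrom ?_)⟩
    intro S hS
    let _ := TopologicalSpace.induced (lift x y z) ‹TopologicalSpace X›
    refine isOpen_iff_mem_nhds.2 fun p hp => ?_
    rw [nhds_induced, mem_comap]
    cases p with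
    | root =>
      rcases hS with ⟨n, m, rfl⟩ | ⟨n, rfl⟩ | ⟨n, m, rfl⟩
      · simp at hp
      · exact hroot n
      · simp [Unm] at hp
    | spine k =>
      rcases hS with ⟨n, m, rfl⟩ | ⟨n, rfl⟩ | ⟨n, m, rfl⟩
      · simp at hp
      · simp [Un] at hp
      · obtain rfl : k = n := by simpa [Unm] using hp
        exact hspine k m
    | tip i j =>
      obtain ⟨W, hW, h⟩ := htip i j
      exact ⟨W, hW, h.trans (singleton_subset_iff.2 hp)⟩
  refine ⟨hind, ?_⟩
  have hyy : ∀ i j, y i = y j → i = j := fun i j h => by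
    by_contra hij
    exact disjoint_left.1 (hKK i j hij) (hyK i) (h ▸ hyK j)
  have hzz : ∀ i j k l, z i j = z k l → i = k ∧ j = l := fun i j k l h => by
    obtain rfl : i = k := by
      by_contra hik
      exact disjoint_left.1 (hKK i k hik) (hzK i j) (h ▸ hzK k l)
    exact ⟨rfl, hinj i h⟩
  have hyx : ∀ n, y n ≠ x := fun n h => hxK n (h ▸ hyK n)
  rintro (_ | i | ⟨i, j⟩) (_ | k | ⟨k, l⟩) h
  · rfl
  · exact absurd h.symm (hyx k)
  · exact absurd h.symm (hzx k l)
  · exact absurd h (hyx i)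
  · rw [hyy i k h]
  · exact absurd h (hyz i k l)
  · exact absurd h (hzx i j)
  · exact absurd h.symm (hyz k i j)
  · obtain ⟨rfl, rfl⟩ := hzz i j k l h
    rfl

/-- A point in the closure of a set, but not in the set, is the limit of an injective sequence
in the set avoiding any other given point. -/
theorem exists_injective_seq_tendsto [FirstCountableTopology X] {S : Set X} {x y : X}
    (hy : y ∈ closure S) (hyS : y ∉ S) (hyx : y ≠ x) :
    ∃ z : ℕ → X, Function.Injective z ∧ (∀ k, z k ∈ S) ∧ (∀ k, z k ≠ x) ∧
      Tendsto z atTop (𝓝 y) := by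
  obtain ⟨z, hzS, hz⟩ := mem_closure_iff_seq_limit.1 hy
  have hR : ∀ n, ∀ᶠ m in atTop, z m ≠ x ∧ z n ≠ z m := fun n =>
    (hz.eventually_ne hyx).and
      ((hz.eventually_ne fun h => hyS (h ▸ hzS n)).mono fun _ => Ne.symm)
  obtain ⟨φ, hφ, h⟩ := exists_strictMono_forall_lt_of_eventually hR
  refine ⟨fun k => z (φ (k + 1)), ?_, fun k => hzS _, fun k => (h k (k + 1) k.lt_succ_self).1,
    hz.comp (hφ.tendsto_atTop.comp (tendsto_add_atTop_nat 1))⟩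
  intro i j hij
  by_contra hne
  rcases lt_or_gt_of_ne hne with hl | hl
  · exact (h (i + 1) (j + 1) (by omega)).2 hij
  · exact (h (j + 1) (i + 1) (by omega)).2 hij.symm

theorem exists_isEmbedding_of_not_regularSpace [FirstCountableTopology X]
    (h : ¬ RegularSpace X) : ∃ f : GutikPoint → X, IsEmbedding f := by
  obtain ⟨x, U, hU, hnot⟩ : ∃ x : X, ∃ U ∈ 𝓝 x, ∀ t ∈ 𝓝 x, IsClosed t → ¬ t ⊆ U := by
    by_contra! hcon
    exact h (RegularSpace.of_exists_mem_nhds_isClosed_subset hcon)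
  obtain ⟨V, hV⟩ := (𝓝 x).exists_antitone_basis
  have hy : ∀ n, ∃ y ∈ closure (V n ∩ U), y ∉ U := fun n =>
    not_subset.1 (hnot _ (mem_of_superset (inter_mem (hV.mem n) hU) subset_closure)
      isClosed_closure)
  choose y hyV hyU using hy
  have hyx : ∀ n, y n ≠ x := fun n h => hyU n (h ▸ mem_of_mem_nhds hU)
  choose z hinj hzS hzx hzy using fun n =>
    exists_injective_seq_tendsto (hyV n) (fun h => hyU n h.2) (hyx n)
  have hR : ∀ n, ∀ᶠ m in atTop, Disjoint (insert (y n) (range (z n))) (closure (V m)) := by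
    refine fun n => eventually_disjoint_closure hV ?_ ?_
    · simpa using isCompact_insert_image_of_tendsto (hzy n) univ
    · rintro (h | ⟨k, h⟩)
      · exact hyx n h.symm
      · exact hzx n k h
  obtain ⟨φ, hφ, hdisj⟩ := exists_strictMono_forall_lt_of_eventually hR
  exact ⟨_, isEmbedding_lift (y := y ∘ φ) (z := z ∘ φ) (hV.comp_strictMono hφ) hU
    (fun n => hyU _) (fun n k => (hzS _ k).2) (fun n k => (hzS _ k).1) (fun n => hzx _)
    (fun n => hinj _) (fun n => hzy _) hdisj⟩

end Lift

end GutikPoint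

theorem not_regular_iff_embeds_gutik_hedgehog {X : Type u} [TopologicalSpace X]
    [FirstCountableTopology X] [T2Space X] :
    ¬ RegularSpace X ↔ ∃ f : GutikPoint → X, Topology.IsEmbedding f := by
  refine ⟨GutikPoint.exists_isEmbedding_of_not_regularSpace, fun ⟨f, hf⟩ _ => ?_⟩
  exact GutikPoint.not_regularSpace hf.isInducing.regularSpace
end
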